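/- The assignment t ↦ P(t) is a bijection from the set of binary trees onto the set of standard dyadic partitions of [0,1]: for every binary tree t the list P(t) is a standard dyadic partition, distinct trees yield distinct partitions, and every standard dyadic partition of [0,1] equals P(t) for some binary tree t. -/

import Mathlib

/-- A planar rooted binary tree. -/
inductive BinTree : Type
  | leaf : BinTree
  | node : BinTree → BinTree → BinTree
deriving DecidableEq

/-- The number of leaves of a binary tree. -/
def BinTree.numLeaves : BinTree → ℕ
  | .leaf => 1
  | .node l r => l.numLeaves + r.numLeaves

/-- The list of intervals (recorded as pairs of endpoints) that a binary tree associates to the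
interval `[a, b]`: a leaf yields `[a,b]` itself, and a node splits `[a,b]` at its midpoint. -/
noncomputable def treePartition : BinTree → ℝ → ℝ → List (ℝ × ℝ)
  | .leaf, a, b => [(a, b)]
  | .node l r, a, b => treePartition l a ((a + b) / 2) ++ treePartition r ((a + b) / 2) b

/-- `[p, q]` is a standard dyadic interval: `p = a / 2 ^ b`, `q = (a + 1) / 2 ^ b` for
nonnegative integers `a`, `b`, and `[p, q] ⊆ [0, 1]`. -/
def IsStdDyadicInterval (p q : ℝ) : Prop :=
  ∃ (a b : ℕ), p = (a : ℝ) / 2 ^ b ∧ q = ((a : ℝ) + 1) / 2 ^ b ∧ q ≤ 1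

/-- `x 0 = 0 < x 1 < ⋯ < x n = 1` is a standard dyadic partition of `[0,1]`: every
subinterval `[x i, x (i+1)]` is a standard dyadic interval. -/
def IsStdDyadicPartition (n : ℕ) (x : ℕ → ℝ) : Prop :=
  0 < n ∧ x 0 = 0 ∧ x n = 1 ∧ ∀ i < n, IsStdDyadicInterval (x i) (x (i + 1))

/-- A list of intervals (pairs of endpoints) is a standard dyadic partition of `[0,1]`:
it is nonempty, starts at `0`, ends at `1`, consists of consecutive intervals, each of which is
a standard dyadic interval. -/
def IsSDPList (L : List (ℝ × ℝ)) : Prop :=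
  L ≠ [] ∧ (L[0]!).1 = 0 ∧ (L[L.length - 1]!).2 = 1 ∧
  (∀ i, i + 1 < L.length → (L[i]!).2 = (L[i + 1]!).1) ∧
  (∀ p ∈ L, IsStdDyadicInterval p.1 p.2)

namespace TreeAux

/-- `L` is a chain of consecutive intervals from `a` to `b`. -/
def Ch : List (ℝ × ℝ) → ℝ → ℝ → Prop
  | [], a, b => a = b
  | p :: L, a, b => p.1 = a ∧ Ch L p.2 b

theorem ch_iff (L : List (ℝ × ℝ)) (hL : L ≠ []) (a b : ℝ) :
    Ch L a b ↔ ((L[0]!).1 = a ∧ (L[L.length - 1]!).2 = b ∧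
      (∀ i, i + 1 < L.length → (L[i]!).2 = (L[i + 1]!).1)) := by
  induction L generalizing a with
  | nil => exact absurd rfl hL
  | cons p L ih =>
    rcases L with _ | ⟨q, L⟩
    · simp [Ch]
    · have h := ih (by simp) p.2
      have e : Ch (p :: q :: L) a b ↔ p.1 = a ∧ Ch (q :: L) p.2 b := Iff.rfl
      rw [e, h]
      constructor
      · rintro ⟨h1, h2, h3, h4⟩
        refine ⟨by simpa using h1, by simpa using h3, ?_⟩
        intro i hi
        rcases i with _ | i
        · simpa using h2.symm
        · have := h4 i (by simpa using hi)
          simpa using this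
      · rintro ⟨h1, h3, h4⟩
        refine ⟨by simpa using h1, ?_, by simpa using h3, ?_⟩
        · have := h4 0 (by simp)
          simpa using this.symm
        · intro i hi
          have := h4 (i + 1) (by simpa using hi)
          simpa using this

theorem ch_append (L M : List (ℝ × ℝ)) (a m b : ℝ) (h1 : Ch L a m) (h2 : Ch M m b) :
    Ch (L ++ M) a b := by
  induction L generalizing a with
  | nil => cases h1; exact h2
  | cons p L ih => exact ⟨h1.1, ih _ h1.2⟩

theorem tp_ne (t : BinTree) (a b : ℝ) : treePartition t a b ≠ [] := by
  induction t generalizing a b with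
  | leaf => simp [treePartition]
  | node l r ihl ihr => simp [treePartition, ihl]

theorem tp_ch (t : BinTree) (a b : ℝ) : Ch (treePartition t a b) a b := by
  induction t generalizing a b with
  | leaf => simp [treePartition, Ch]
  | node l r ihl ihr => exact ch_append _ _ _ _ _ (ihl _ _) (ihr _ _)

theorem dy_lt {p q : ℝ} (h : IsStdDyadicInterval p q) : p < q := by
  obtain ⟨a, b, rfl, rfl, -⟩ := h
  gcongr
  linarith

theorem dy_half {p q : ℝ} (h : IsStdDyadicInterval p q) :
    IsStdDyadicInterval p ((p + q) / 2) ∧ IsStdDyadicInterval ((p + q) / 2) q := by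
  have hlt := dy_lt h
  obtain ⟨a, b, hp, hq, h1⟩ := h
  refine ⟨⟨2 * a, b + 1, ?_, ?_, by linarith⟩, ⟨2 * a + 1, b + 1, ?_, ?_, h1⟩⟩ <;>
  · rw [pow_succ]
    push_cast
    try rw [hp]
    try rw [hq]
    field_simp
    try ring

theorem tp_dy (t : BinTree) (a b : ℝ) (h : IsStdDyadicInterval a b) :
    ∀ p ∈ treePartition t a b, IsStdDyadicInterval p.1 p.2 := by
  induction t generalizing a b with
  | leaf => simpa [treePartition] using h
  | node l r ihl ihr =>
    intro p hp
    rcases List.mem_append.1 hp with hp | hp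
    · exact ihl _ _ (dy_half h).1 p hp
    · exact ihr _ _ (dy_half h).2 p hp

theorem tp_bd (t : BinTree) (a b : ℝ) (h : a < b) :
    ∀ p ∈ treePartition t a b, a ≤ p.1 ∧ p.1 < p.2 ∧ p.2 ≤ b := by
  induction t generalizing a b with
  | leaf => simpa [treePartition] using h
  | node l r ihl ihr =>
    intro p hp
    rcases List.mem_append.1 hp with hp | hp
    · obtain ⟨h1, h2, h3⟩ := ihl _ _ (by linarith) p hp
      exact ⟨h1, h2, by linarith⟩
    · obtain ⟨h1, h2, h3⟩ := ihr _ _ (by linarith) p hp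
      exact ⟨by linarith, h2, h3⟩

theorem tp_filter (l r : BinTree) (a b : ℝ) (h : a < b) :
    (treePartition (.node l r) a b).filter (fun p => decide (p.2 ≤ (a + b) / 2)) =
      treePartition l a ((a + b) / 2) := by
  rw [treePartition, List.filter_append, List.filter_eq_self.2, List.filter_eq_nil_iff.2,
    List.append_nil]
  · intro p hp
    obtain ⟨h1, h2, h3⟩ := tp_bd r _ _ (by linarith) p hp
    simp only [decide_eq_true_eq, not_le]
    linarith
  · intro p hp
    obtain ⟨h1, h2, h3⟩ := tp_bd l _ _ (by linarith) p hp
    simpa using h3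

theorem tp_len (l r : BinTree) (a b x y : ℝ) :
    treePartition (.node l r) a b ≠ treePartition .leaf x y := by
  intro h
  have h := congrArg List.length h
  have h1 := List.length_pos_of_ne_nil (tp_ne l a ((a + b) / 2))
  have h2 := List.length_pos_of_ne_nil (tp_ne r ((a + b) / 2) b)
  simp only [treePartition, List.length_append, List.length_singleton] at h
  omega

theorem tp_inj (s t : BinTree) (a b : ℝ) (hab : a < b)
    (h : treePartition s a b = treePartition t a b) : s = t := by
  induction s generalizing t a b with
  | leaf =>
    cases t with
    | leaf => rfl
    | node l r => exact absurd h.symm (tp_len _ _ _ _ _ _)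
  | node l r ihl ihr =>
    cases t with
    | leaf => exact absurd h (tp_len _ _ _ _ _ _)
    | node l' r' =>
      have e : treePartition l a ((a + b) / 2) = treePartition l' a ((a + b) / 2) := by
        rw [← tp_filter l r a b hab, h, tp_filter l' r' a b hab]
      have e2 : treePartition r ((a + b) / 2) b = treePartition r' ((a + b) / 2) b := by
        rw [treePartition, treePartition, e] at h
        exact List.append_cancel_left h
      rw [ihl _ _ _ (by linarith) e, ihr _ _ _ (by linarith) e2]

theorem ch_bd (L : List (ℝ × ℝ)) (a b : ℝ) (h : Ch L a b) (hd : ∀ p ∈ L, p.1 < p.2) :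
    a ≤ b ∧ ∀ p ∈ L, a ≤ p.1 ∧ p.2 ≤ b := by
  induction L generalizing a with
  | nil => exact ⟨le_of_eq h, by simp⟩
  | cons p L ih =>
    obtain ⟨h1, h2⟩ := h
    have hp := hd p (by simp)
    obtain ⟨h3, h4⟩ := ih _ h2 (fun q hq => hd q (by simp [hq]))
    refine ⟨by linarith, ?_⟩
    intro q hq
    rcases List.mem_cons.1 hq with rfl | hq
    · exact ⟨h1.ge, h3⟩
    · obtain ⟨h5, h6⟩ := h4 q hq
      exact ⟨by linarith, h6⟩

theorem ch_whole (L : List (ℝ × ℝ)) (a b : ℝ) (h : Ch L a b) (hd : ∀ p ∈ L, p.1 < p.2)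
    (hm : (a, b) ∈ L) : L = [(a, b)] := by
  rcases L with _ | ⟨p, L⟩
  · simp at hm
  · obtain ⟨h1, h2⟩ := h
    have hp := hd p (by simp)
    obtain ⟨h3, h4⟩ := ch_bd _ _ _ h2 (fun q hq => hd q (by simp [hq]))
    rcases List.mem_cons.1 hm with rfl | hm
    · rcases L with _ | ⟨q, L⟩
      · rfl
      · have h5 := hd q (by simp)
        have h6 := h4 q (by simp)
        simp only at h6
        linarith
    · have := (h4 _ hm).1
      simp only at this
      linarith

theorem ch_split (L : List (ℝ × ℝ)) (a m b : ℝ) (h : Ch L a b)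
    (hs : ∀ p ∈ L, p.2 ≤ m ∨ m ≤ p.1) (ham : a ≤ m) (hmb : m ≤ b) :
    ∃ L1 L2, L = L1 ++ L2 ∧ Ch L1 a m ∧ Ch L2 m b := by
  induction L generalizing a with
  | nil =>
    have h : a = b := h
    exact ⟨[], [], rfl, le_antisymm ham (h ▸ hmb), le_antisymm hmb (h ▸ ham)⟩
  | cons p L ih =>
    rcases hs p (by simp) with hp | hp
    · obtain ⟨L1, L2, rfl, h1, h2⟩ := ih _ h.2 (fun q hq => hs q (by simp [hq])) hp
      exact ⟨p :: L1, L2, rfl, ⟨h.1, h1⟩, h2⟩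
    · have e : a = m := le_antisymm ham (h.1 ▸ hp)
      exact ⟨[], p :: L, rfl, e, e ▸ h⟩

theorem dy_nested {a b p q : ℝ} (h : IsStdDyadicInterval a b) (h' : IsStdDyadicInterval p q)
    (hap : a ≤ p) (hqb : q ≤ b) (hne : ¬ (p = a ∧ q = b)) :
    q ≤ (a + b) / 2 ∨ (a + b) / 2 ≤ p := by
  obtain ⟨k, n, rfl, rfl, -⟩ := h
  obtain ⟨c, d, rfl, rfl, -⟩ := h'
  rcases le_or_gt d n with hdn | hdn
  · exfalso
    apply hne
    have h2 : (1 : ℝ) / 2 ^ n ≤ 1 / 2 ^ d :=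
      one_div_le_one_div_of_le (by positivity) (pow_le_pow_right₀ (by norm_num) hdn)
    rw [add_div] at *
    rw [add_div] at *
    constructor <;> linarith
  · obtain ⟨e, rfl⟩ := Nat.exists_eq_add_of_lt hdn
    have hm : ((k : ℝ) / 2 ^ n + (k + 1) / 2 ^ n) / 2 =
        (((2 * k + 1) * 2 ^ e : ℕ) : ℝ) / 2 ^ (n + e + 1) := by
      push_cast
      rw [pow_succ, pow_add]
      field_simp
      ring
    rw [hm]
    rcases le_or_gt (c + 1) ((2 * k + 1) * 2 ^ e) with h | h
    · left
      gcongr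
      exact_mod_cast h
    · right
      gcongr
      omega

theorem tp_surj (N : ℕ) : ∀ (L : List (ℝ × ℝ)) (a b : ℝ), L.length ≤ N →
    IsStdDyadicInterval a b → Ch L a b →
    (∀ p ∈ L, IsStdDyadicInterval p.1 p.2) → ∃ t, treePartition t a b = L := by
  induction N with
  | zero =>
    intro L a b hN hab h hd
    have : L = [] := by simpa using hN
    subst this
    have e : a = b := h
    exact absurd e (dy_lt hab).ne
  | succ N ih =>
    intro L a b hN hab h hd
    have hlt := dy_lt hab
    have hd' : ∀ p ∈ L, p.1 < p.2 := fun p hp => dy_lt (hd p hp)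
    by_cases hm : (a, b) ∈ L
    · exact ⟨.leaf, (ch_whole L a b h hd' hm).symm⟩
    · have hb := (ch_bd L a b h hd').2
      obtain ⟨L1, L2, rfl, h1, h2⟩ := ch_split L a ((a + b) / 2) b h (by
        intro p hp
        refine dy_nested hab (hd p hp) (hb p hp).1 (hb p hp).2 ?_
        rintro ⟨rfl, rfl⟩
        exact hm hp) (by linarith) (by linarith)
      have n1 : 0 < L1.length := by
        rcases L1 with _ | ⟨q, L1⟩
        · have e : a = (a + b) / 2 := h1
          linarith
        · simp
      have n2 : 0 < L2.length := by
        rcases L2 with _ | ⟨q, L2⟩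
        · have e : (a + b) / 2 = b := h2
          linarith
        · simp
      rw [List.length_append] at hN
      obtain ⟨l, hl⟩ := ih L1 _ _ (by omega) (dy_half hab).1 h1
        (fun p hp => hd p (List.mem_append_left _ hp))
      obtain ⟨r, hr⟩ := ih L2 _ _ (by omega) (dy_half hab).2 h2
        (fun p hp => hd p (List.mem_append_right _ hp))
      exact ⟨.node l r, by rw [treePartition, hl, hr]⟩

theorem dy_unit : IsStdDyadicInterval 0 1 := ⟨0, 0, by simp, by simp, le_refl _⟩

end TreeAux

/-- The map `t ↦ P(t) = treePartition t 0 1` is a bijection from binary trees onto standard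
dyadic partitions of `[0,1]`. -/
theorem treePartition_bijective :
    (∀ t : BinTree, IsSDPList (treePartition t 0 1)) ∧
    (∀ s t : BinTree, treePartition s 0 1 = treePartition t 0 1 → s = t) ∧
    (∀ L : List (ℝ × ℝ), IsSDPList L → ∃ t : BinTree, treePartition t 0 1 = L) := by
  refine ⟨fun t => ?_, fun s t h => TreeAux.tp_inj s t 0 1 one_pos h, fun L h => ?_⟩
  · have hne := TreeAux.tp_ne t 0 1
    obtain ⟨h1, h2, h3⟩ := (TreeAux.ch_iff _ hne 0 1).1 (TreeAux.tp_ch t 0 1)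
    exact ⟨hne, h1, h2, h3, TreeAux.tp_dy t 0 1 TreeAux.dy_unit⟩
  · obtain ⟨hne, h1, h2, h3, h4⟩ := h
    exact TreeAux.tp_surj _ L 0 1 le_rfl TreeAux.dy_unit
      ((TreeAux.ch_iff L hne 0 1).2 ⟨h1, h2, h3⟩) h4
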